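/- Let f : [0,∞) → ℝ be continuous with |f(x)| ≤ β e^{αx} for some α, β > 0, and let a > 0. Then under the hypotheses on T_n* (Sheffer polynomials p_k ≥ 0, A(1) ≠ 0, H'(1) = 1, b_n → ∞, b_n/n → 0), the operators T_n*(f; ·) converge uniformly to f on [0, a] as n → ∞. -/

import Mathlib

open Real Filter Topology

/-- The Chlodowsky-type generalized Szász operator built from Sheffer polynomials `p`. -/
noncomputable def szaszSheffer (A H : ℝ → ℝ) (p : ℕ → ℝ → ℝ) (b : ℕ → ℝ)
    (n : ℕ) (f : ℝ → ℝ) (x : ℝ) : ℝ :=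
  (Real.exp (-((n : ℝ) / b n) * x * H 1) / A 1) *
    ∑' k : ℕ, p k (((n : ℝ) / b n) * x) * f (((k : ℝ) / n) * b n)

lemma aux_hs {f g : ℕ → ℝ} {a b : ℝ} (h : HasSum f a) (hf : ∀ k, g k = f k) (hab : b = a) :
    HasSum g b := by
  have : g = f := funext hf
  rw [this, hab]
  exact h

lemma aux_cont (R : ℝ) (hR : 1 < R) (A : ℝ → ℝ) (a : ℕ → ℝ)
    (hAser : ∀ t : ℝ, |t| < R → HasSum (fun k : ℕ => a k * t ^ k) (A t)) :
    ContinuousAt A 1 := by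
  obtain ⟨ρ, h1, h2⟩ := exists_between hR
  have hρ : |ρ| < R := by rw [abs_of_pos (by linarith)]; exact h2
  have hs : Summable (fun k => |a k * ρ ^ k|) := (hAser ρ hρ).summable.abs
  have hc : ContinuousOn (fun t : ℝ => ∑' k, a k * t ^ k) (Set.Icc (-ρ) ρ) := by
    refine continuousOn_tsum (fun k => by fun_prop) hs ?_
    intro k t ht
    rw [Real.norm_eq_abs, abs_mul, abs_mul, abs_pow, abs_pow]
    have : |t| ≤ |ρ| := by
      rw [abs_of_pos (show 0 < ρ by linarith)]; exact abs_le.2 ht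
    gcongr
  have hN : Set.Icc (-ρ) ρ ∈ 𝓝 (1:ℝ) := Icc_mem_nhds (by linarith) h1
  refine (hc.continuousAt hN).congr ?_
  filter_upwards [hN] with t ht
  exact (hAser t (lt_of_le_of_lt (abs_le.2 ht) h2)).tsum_eq

lemma aux_sum (w u F : ℕ → ℝ) (E1 E2 v y ε C : ℝ) (hw : ∀ k, 0 ≤ w k)
    (h0 : HasSum w 1) (h1 : HasSum (fun k => w k * u k) E1)
    (h2 : HasSum (fun k => w k * u k ^ 2) E2)
    (hF : ∀ k, |F k - y| ≤ ε + C * (u k - v) ^ 2) :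
    |∑' k, w k * F k - y| ≤ ε + C * (E2 - 2 * v * E1 + v ^ 2) := by
  have hB : HasSum (fun k => w k * (ε + C * (u k - v) ^ 2))
      (ε + C * (E2 - 2 * v * E1 + v ^ 2)) := by
    refine aux_hs ((h0.mul_left (ε + C * v ^ 2)).add
      ((h2.mul_left C).sub (h1.mul_left (2 * C * v)))) ?_ ?_
    · intro k
      ring
    · ring
  have hle : ∀ k, ‖w k * (F k - y)‖ ≤ w k * (ε + C * (u k - v) ^ 2) := fun k => by
    rw [Real.norm_eq_abs, abs_mul, abs_of_nonneg (hw k)]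
    exact mul_le_mul_of_nonneg_left (hF k) (hw k)
  have hsD : Summable (fun k => w k * (F k - y)) := Summable.of_norm_bounded hB.summable hle
  have hS : HasSum (fun k => w k * F k) (∑' k, w k * (F k - y) + y) := by
    refine aux_hs (hsD.hasSum.add (h0.mul_right y)) ?_ ?_
    · intro k; ring
    · ring
  rw [hS.tsum_eq, add_sub_cancel_right]
  exact tsum_of_norm_bounded hB hle

lemma aux_bound (f : ℝ → ℝ) (hf : ContinuousOn f (Set.Ici 0))
    (α β : ℝ) (hα : 0 < α) (hβ : 0 < β)
    (hgrowth : ∀ x : ℝ, 0 ≤ x → |f x| ≤ β * Real.exp (α * x))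
    (c : ℝ) (ε : ℝ) (hε : 0 < ε) :
    ∃ C > 0, ∀ x ∈ Set.Icc 0 c, ∀ y, 0 ≤ y →
      |f y - f x| ≤ ε + C * (Real.exp (α * y) - Real.exp (α * x)) ^ 2 := by
  set M := Real.exp (α * c) with hM
  have hMp : 0 < M := Real.exp_pos _
  set g : ℝ → ℝ := fun u => f (Real.log u / α) with hg
  have hgc : ContinuousOn g (Set.Icc 1 (M + 1)) := by
    refine hf.comp ?_ ?_
    · refine ContinuousOn.div_const (Real.continuousOn_log.mono ?_) _
      intro u hu
      simp only [Set.mem_compl_iff, Set.mem_singleton_iff]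
      have := hu.1
      linarith
    · intro u hu
      exact div_nonneg (Real.log_nonneg hu.1) hα.le
  have huc := isCompact_Icc.uniformContinuousOn_of_continuous hgc
  rw [Metric.uniformContinuousOn_iff] at huc
  obtain ⟨η0, hη0, hu⟩ := huc ε hε
  set η := min η0 1 with hη
  have hηp : 0 < η := lt_min hη0 one_pos
  have hgf : ∀ y, g (Real.exp (α * y)) = f y := fun y => by
    simp only [hg, Real.log_exp]; congr 1; field_simp
  refine ⟨β * (1 / η + 2 * M / η ^ 2), by positivity, ?_⟩
  intro x hx y hy
  have hv1 : 1 ≤ Real.exp (α * x) := Real.one_le_exp (mul_nonneg hα.le hx.1)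
  have hvM : Real.exp (α * x) ≤ M := Real.exp_le_exp.2 (mul_le_mul_of_nonneg_left hx.2 hα.le)
  have hu1 : 1 ≤ Real.exp (α * y) := Real.one_le_exp (mul_nonneg hα.le hy)
  have hfx := hgrowth x hx.1
  have hfy := hgrowth y hy
  rw [← hgf x, ← hgf y] at *
  generalize Real.exp (α * x) = v at *
  generalize Real.exp (α * y) = u at *
  rcases lt_or_ge |u - v| η with hlt | hge
  · have h1 : |u - v| < 1 := hlt.trans_le (min_le_right _ _)
    have h2 : u ≤ M + 1 := by have := (abs_lt.1 h1).2; linarith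
    have := hu u ⟨hu1, h2⟩ v ⟨hv1, by linarith⟩ (by
      rw [Real.dist_eq]; exact hlt.trans_le (min_le_left _ _))
    rw [Real.dist_eq] at this
    have : 0 ≤ β * (1 / η + 2 * M / η ^ 2) * (u - v) ^ 2 := by positivity
    linarith
  · have h1 : |g u - g v| ≤ β * u + β * v := (abs_sub _ _).trans (add_le_add hfy hfx)
    have h2 : β * u + β * v ≤ β * (|u - v| + 2 * M) := by
      have := le_abs_self (u - v)
      have : u + v ≤ |u - v| + 2 * M := by linarith
      nlinarith
    rw [← sq_abs (u - v)]
    set d := |u - v|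
    have hd1 : d ≤ 1 / η * d ^ 2 := by
      rw [div_mul_eq_mul_div, le_div_iff₀ hηp]; nlinarith
    have hd2 : 2 * M ≤ 2 * M / η ^ 2 * d ^ 2 := by
      rw [div_mul_eq_mul_div, le_div_iff₀ (by positivity)]
      have : η ^ 2 ≤ d ^ 2 := pow_le_pow_left₀ hηp.le hge 2
      nlinarith
    have : β * (d + 2 * M) ≤ β * (1 / η + 2 * M / η ^ 2) * d ^ 2 := by
      rw [mul_assoc]
      refine mul_le_mul_of_nonneg_left ?_ hβ.le
      linarith
    linarith

lemma aux_unif (α c ε : ℝ) (hε : 0 < ε) (r1 q1 r2 q2 : ℕ → ℝ)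
    (hr1 : Tendsto r1 atTop (𝓝 1)) (hq1 : Tendsto q1 atTop (𝓝 α))
    (hr2 : Tendsto r2 atTop (𝓝 1)) (hq2 : Tendsto q2 atTop (𝓝 (2 * α))) :
    ∀ᶠ n in atTop, ∀ x ∈ Set.Icc 0 c,
      r2 n * Real.exp (x * q2 n) - 2 * Real.exp (α * x) * (r1 n * Real.exp (x * q1 n))
        + Real.exp (α * x) ^ 2 < ε := by
  have hz : Tendsto (fun n => (r1 n, q1 n, r2 n, q2 n)) atTop (𝓝 ((1:ℝ), α, (1:ℝ), 2 * α)) :=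
    hr1.prodMk_nhds (hq1.prodMk_nhds (hr2.prodMk_nhds hq2))
  refine hz.eventually (p := fun z : ℝ × ℝ × ℝ × ℝ => ∀ x ∈ Set.Icc 0 c,
      z.2.2.1 * Real.exp (x * z.2.2.2) - 2 * Real.exp (α * x) * (z.1 * Real.exp (x * z.2.1))
        + Real.exp (α * x) ^ 2 < ε) ?_
  refine isCompact_Icc.eventually_forall_of_forall_eventually ?_
  intro x hx
  refine ContinuousAt.eventually_lt (by fun_prop) continuousAt_const ?_
  simp only
  have e1 : Real.exp (x * (2 * α)) = Real.exp (α * x) ^ 2 := by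
    rw [← Real.exp_nat_mul]; congr 1; push_cast; ring
  rw [e1, mul_comm x α]
  nlinarith

theorem sheffer_uniform_convergence
    (R : ℝ) (hR : 1 < R)
    (A H : ℝ → ℝ) (a h : ℕ → ℝ)
    (ha0 : a 0 ≠ 0) (hh1 : h 1 ≠ 0) (hh0 : h 0 = 0)
    (hAser : ∀ t : ℝ, |t| < R → HasSum (fun k : ℕ => a k * t ^ k) (A t))
    (hHser : ∀ t : ℝ, |t| < R → HasSum (fun k : ℕ => h k * t ^ k) (H t))
    (p : ℕ → ℝ → ℝ)
    (hgen : ∀ x t : ℝ, |t| < R →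
      HasSum (fun k : ℕ => p k x * t ^ k) (A t * Real.exp (x * H t)))
    (hp : ∀ (k : ℕ) (x : ℝ), 0 ≤ x → 0 ≤ p k x)
    (hA1 : A 1 ≠ 0) (hH1 : deriv H 1 = 1)
    (b : ℕ → ℝ) (hbpos : ∀ n, 0 < b n)
    (hbtop : Tendsto b atTop atTop)
    (hbn : Tendsto (fun n : ℕ => b n / (n : ℝ)) atTop (nhds 0))
    (f : ℝ → ℝ) (hf : ContinuousOn f (Set.Ici 0))
    (α β : ℝ) (hα : 0 < α) (hβ : 0 < β)
    (hgrowth : ∀ x : ℝ, 0 ≤ x → |f x| ≤ β * Real.exp (α * x))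
    (c : ℝ) (hc : 0 < c) :
    TendstoUniformlyOn (fun n x => szaszSheffer A H p b n f x) f atTop (Set.Icc 0 c) := by
  have hA1p : 0 < A 1 := by
    have h1 := hgen 0 1 (by simpa using hR)
    have : 0 ≤ A 1 * Real.exp (0 * H 1) := h1.nonneg (fun k => by simpa using hp k 0 le_rfl)
    simp at this
    exact lt_of_le_of_ne this (Ne.symm hA1)
  have hAc := aux_cont R hR A a hAser
  have hHd : HasDerivAt H 1 1 := by
    have : DifferentiableAt ℝ H 1 := by
      by_contra hcon
      rw [deriv_zero_of_not_differentiableAt hcon] at hH1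
      norm_num at hH1
    simpa [hH1] using this.hasDerivAt
  have hexp : ∀ s : ℝ, Tendsto (fun n : ℕ => Real.exp (s * (b n / n))) atTop (𝓝 1) := fun s => by
    have := (Real.continuous_exp.tendsto _).comp (hbn.const_mul s)
    simpa [Function.comp_def] using this
  have hr : ∀ s : ℝ, Tendsto (fun n : ℕ => A (Real.exp (s * (b n / n))) / A 1) atTop (𝓝 1) :=
    fun s => by
      have := (hAc.tendsto.comp (hexp s)).div_const (A 1)
      simpa [div_self hA1] using this
  have hq : ∀ s : ℝ, Tendsto
      (fun n : ℕ => ((n : ℝ) / b n) * (H (Real.exp (s * (b n / n))) - H 1)) atTop (𝓝 s) :=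
    fun s => by
      have hd : HasDerivAt (fun d : ℝ => H (Real.exp (s * d))) s 0 := by
        have h1 : HasDerivAt (fun d : ℝ => Real.exp (s * d)) s 0 := by
          simpa using ((hasDerivAt_id (0:ℝ)).const_mul s).exp
        have h2 : HasDerivAt H 1 (Real.exp (s * 0)) := by simpa using hHd
        simpa [Function.comp_def] using h2.comp (0:ℝ) h1
      have hne : Tendsto (fun n : ℕ => b n / (n : ℝ)) atTop (𝓝[≠] 0) := by
        refine tendsto_nhdsWithin_iff.2 ⟨hbn, ?_⟩
        filter_upwards [eventually_gt_atTop 0] with n hn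
        have : (0:ℝ) < n := by exact_mod_cast hn
        exact (div_pos (hbpos n) this).ne'
      have := hd.tendsto_slope_zero.comp hne
      simpa [Function.comp_def] using this
  rw [Metric.tendstoUniformlyOn_iff]
  intro ε hε
  obtain ⟨C, hC, hbd⟩ := aux_bound f hf α β hα hβ hgrowth c (ε / 2) (half_pos hε)
  have hev := aux_unif α c (ε / 2 / C) (by positivity) _ _ _ _ (hr α) (hq α) (hr (2 * α))
    (hq (2 * α))
  have hlt : ∀ s : ℝ, ∀ᶠ n : ℕ in atTop, Real.exp (s * (b n / n)) < R := fun s =>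
    (hexp s).eventually_lt_const hR
  filter_upwards [hev, hlt α, hlt (2 * α), eventually_gt_atTop 0] with n hn ht1 ht2 hn0 x hx
  have hnp : (0:ℝ) < n := by exact_mod_cast hn0
  have hb := hbpos n
  set m := (n : ℝ) / b n with hm
  have hmp : 0 < m := div_pos hnp hb
  set W := Real.exp (-m * x * H 1) / A 1 with hW
  have hWp : 0 < W := div_pos (Real.exp_pos _) hA1p
  have key : ∀ s : ℝ, Real.exp (s * (b n / n)) < R →
      HasSum (fun k : ℕ => W * p k (m * x) * Real.exp (s * (k / n * b n)))
        (A (Real.exp (s * (b n / n))) / A 1 *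
          Real.exp (x * (m * (H (Real.exp (s * (b n / n))) - H 1)))) := by
    intro s hs
    have h1 := (hgen (m * x) (Real.exp (s * (b n / n)))
      (by rwa [abs_of_pos (Real.exp_pos _)])).mul_left W
    refine aux_hs h1 ?_ ?_
    · intro k
      rw [← Real.exp_nat_mul, mul_assoc]
      congr 3
      ring
    · rw [hW]
      have : x * (m * (H (Real.exp (s * (b n / n))) - H 1))
        = -m * x * H 1 + m * x * H (Real.exp (s * (b n / n))) := by ring
      rw [this, Real.exp_add]
      ring
  have k0 : HasSum (fun k : ℕ => W * p k (m * x)) 1 := by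
    have := key 0 (by simpa using hR)
    simpa [div_self hA1] using this
  have k1 := key α ht1
  have k2 : HasSum (fun k : ℕ => W * p k (m * x) * Real.exp (α * (k / n * b n)) ^ 2)
      (A (Real.exp (2 * α * (b n / n))) / A 1 *
        Real.exp (x * (m * (H (Real.exp (2 * α * (b n / n))) - H 1)))) := by
    refine aux_hs (key (2 * α) ht2) ?_ rfl
    intro k
    rw [← Real.exp_nat_mul]
    congr 2
    push_cast
    ring
  have hmain := aux_sum (fun k => W * p k (m * x)) (fun k => Real.exp (α * (k / n * b n)))
    (fun k => f (k / n * b n)) _ _ (Real.exp (α * x)) (f x) (ε / 2) C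
    (fun k => mul_nonneg hWp.le (hp k _ (mul_nonneg hmp.le hx.1))) k0 k1 k2
    (fun k => hbd x hx _ (by positivity))
  have hS : szaszSheffer A H p b n f x = ∑' k : ℕ, W * p k (m * x) * f (k / n * b n) := by
    simp only [mul_assoc W, tsum_mul_left]
    rfl
  rw [dist_comm, Real.dist_eq, hS]
  refine hmain.trans_lt ?_
  have h3 := hn x hx
  rw [lt_div_iff₀ hC] at h3
  linarith
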